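/- The type-II Boltzmann weights of the U_{q,p}(sl_3) ABF model satisfy the Yang–Baxter equation: for all u₁, u₂ ∈ ℝ and all heights a, b, c, d, e, f ∈ P for which every theta-function denominator appearing in the weights is nonzero, ∑_{g ∈ P} W*(d,e;c,g|u₁) · W*(c,g;b,a|u₂) · W*(e,f;g,a|u₁−u₂) = ∑_{g ∈ P} W*(g,f;b,a|u₁) · W*(d,e;g,f|u₂) · W*(d,g;c,b|u₁−u₂). -/

import Mathlib

noncomputable section

open scoped BigOperators

attribute [local instance] Classical.propDecidable

namespace ABF

/-- The ambient space `ℝ³`. -/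
abbrev V : Type := Fin 3 → ℝ

/-- The standard inner product on `ℝ³`. -/
def ip (v w : V) : ℝ := ∑ i, v i * w i

/-- The orthonormal basis `ε_μ`. -/
def eps (μ : Fin 3) : V := fun ν => if ν = μ then 1 else 0

/-- `ε̄_μ = ε_μ − (ε₁+ε₂+ε₃)/3`. -/
def epsbar (μ : Fin 3) : V := eps μ - (1 / 3 : ℝ) • (eps 0 + eps 1 + eps 2)

/-- The `sl₃` weight lattice `P = ∑ ℤ ε̄_μ`. -/
def P : AddSubgroup V := AddSubgroup.closure (Set.range epsbar)

/-- `ρ = 2ε̄₁ + ε̄₂`. -/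
def rho : V := (2 : ℝ) • epsbar 0 + epsbar 1

/-- `a_μ = (a+ρ | ε̄_μ)`. -/
def ht (a : V) (μ : Fin 3) : ℝ := ip (a + rho) (epsbar μ)

/-- `a_{μ,ν} = a_μ − a_ν`. -/
def htd (a : V) (μ ν : Fin 3) : ℝ := ht a μ - ht a ν

/-- The infinite product `(z;q)_∞`. -/
def poch (z q : ℝ) : ℝ := ∏' j : ℕ, (1 - q ^ j * z)

/-- The double infinite product `(z;q₁,q₂)_∞`. -/
def poch2 (z q₁ q₂ : ℝ) : ℝ := ∏' p : ℕ × ℕ, (1 - q₁ ^ p.1 * q₂ ^ p.2 * z)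

/-- The theta function `Θ_q(z) = (q;q)_∞ (z;q)_∞ (q/z;q)_∞`. -/
def theta (q z : ℝ) : ℝ := poch q q * poch z q * poch (q / z) q

/-- The elliptic theta function `[u] = x^{u²/r−u} Θ_{x^{2r}}(x^{2u})`. -/
def bra (x r u : ℝ) : ℝ := x ^ (u ^ 2 / r - u) * theta (x ^ (2 * r)) (x ^ (2 * u))

/-- `h₁(z)`. -/
def h1fun (x r z : ℝ) : ℝ :=
  poch2 (x ^ (2 : ℝ) * z) (x ^ (2 * r)) (x ^ (6 : ℝ)) *
      poch2 (x ^ (2 * r + 4) * z) (x ^ (2 * r)) (x ^ (6 : ℝ)) /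
    (poch2 (x ^ (2 * r) * z) (x ^ (2 * r)) (x ^ (6 : ℝ)) *
      poch2 (x ^ (6 : ℝ) * z) (x ^ (2 * r)) (x ^ (6 : ℝ)))

/-- `r₁(u) = z^{2(r−1)/(3r)} h₁(z⁻¹)/h₁(z)`, `z = x^{2u}`. -/
def r1 (x r u : ℝ) : ℝ :=
  (x ^ (2 * u)) ^ (2 * (r - 1) / (3 * r)) * h1fun x r (x ^ (2 * u))⁻¹ / h1fun x r (x ^ (2 * u))

/-- `idx v = some μ` if `v = ε̄_μ`, and `none` otherwise. -/
def idx (v : V) : Option (Fin 3) :=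
  if h : ∃ μ : Fin 3, v = epsbar μ then some h.choose else none

/-- The bulk Boltzmann weight `W(a,b;c,d|u)` (top `a`, upper-right `b`, lower-left `c`,
bottom `d`):  it is `r₁(u)` on configurations `(d+2ε̄_μ, d+ε̄_μ; d+ε̄_μ, d)`,
`r₁(u)·[u][d_{μν}−1]/([u−1][d_{μν}])` on `(d+ε̄_μ+ε̄_ν, d+ε̄_μ; d+ε̄_ν, d)` with `μ ≠ ν`,
`r₁(u)·[u−d_{μν}][1]/([u−1][d_{μν}])` on `(d+ε̄_μ+ε̄_ν, d+ε̄_ν; d+ε̄_ν, d)` with `μ ≠ ν`,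
and `0` otherwise. -/
def W (x r : ℝ) (a b c d : V) (u : ℝ) : ℝ :=
  match idx (b - d), idx (a - b), idx (c - d), idx (a - c) with
  | some p, some q, some p', some q' =>
      if q = p ∧ p' = p ∧ q' = p then r1 x r u
      else if p ≠ q ∧ p' = q ∧ q' = p then
        r1 x r u * (bra x r u * bra x r (htd d p q - 1)) /
          (bra x r (u - 1) * bra x r (htd d p q))
      else if p ≠ q ∧ p' = p ∧ q' = q then
        r1 x r u * (bra x r (u - htd d q p) * bra x r 1) /
          (bra x r (u - 1) * bra x r (htd d q p))
      else 0
  | _, _, _, _ => 0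


/-- The starred elliptic theta function `[u]* = x^{u²/r*−u} Θ_{x^{2r*}}(x^{2u})`, `r* = r−1`. -/
def braS (x r u : ℝ) : ℝ := bra x (r - 1) u

/-- `h₁*(z)`. -/
def h1funS (x r z : ℝ) : ℝ :=
  poch2 z (x ^ (2 * (r - 1))) (x ^ (6 : ℝ)) *
      poch2 (x ^ (4 : ℝ) * z) (x ^ (2 * (r - 1))) (x ^ (6 : ℝ)) /
    (poch2 (x ^ (2 * (r - 1)) * z) (x ^ (2 * (r - 1))) (x ^ (6 : ℝ)) *
      poch2 (x ^ (6 : ℝ) * z) (x ^ (2 * (r - 1))) (x ^ (6 : ℝ)))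

/-- `r₁*(u) = z^{2r/(3r*)} h₁*(z⁻¹)/h₁*(z)`, `z = x^{2u}`, `r* = r−1`. -/
def r1S (x r u : ℝ) : ℝ :=
  (x ^ (2 * u)) ^ (2 * r / (3 * (r - 1))) * h1funS x r (x ^ (2 * u))⁻¹ / h1funS x r (x ^ (2 * u))

/-- The type-II Boltzmann weight `W*(a,b;c,d|u)` of the `U_{q,p}(sl₃)` ABF model:
it is `r₁*(u)` on configurations `(d+2ε̄_μ, d+ε̄_μ; d+ε̄_μ, d)`,
`r₁*(u)·[u]*[d_{μν}−1]*/([u−1]*[d_{μν}]*)` on `(d+ε̄_μ+ε̄_ν, d+ε̄_μ; d+ε̄_ν, d)` with `μ ≠ ν`,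
`r₁*(u)·[u−d_{μν}]*[1]*/([u−1]*[d_{μν}]*)` on `(d+ε̄_μ+ε̄_ν, d+ε̄_ν; d+ε̄_ν, d)` with `μ ≠ ν`,
and `0` otherwise. -/
def WS (x r : ℝ) (a b c d : V) (u : ℝ) : ℝ :=
  match idx (b - d), idx (a - b), idx (c - d), idx (a - c) with
  | some p, some q, some p', some q' =>
      if q = p ∧ p' = p ∧ q' = p then r1S x r u
      else if p ≠ q ∧ p' = q ∧ q' = p then
        r1S x r u * (braS x r u * braS x r (htd d p q - 1)) /
          (braS x r (u - 1) * braS x r (htd d p q))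
      else if p ≠ q ∧ p' = p ∧ q' = q then
        r1S x r u * (braS x r (u - htd d q p) * braS x r 1) /
          (braS x r (u - 1) * braS x r (htd d q p))
      else 0
  | _, _, _, _ => 0

section

open Filter Topology

/-- finite q-factorial -/
def qf (q : ℝ) (n : ℕ) : ℝ := ∏ j ∈ Finset.range n, (1 - q ^ j * q)

/-- reciprocal q-factorial extended by zero to the integers -/
def gi (q : ℝ) (m : ℤ) : ℝ := if 0 ≤ m then (qf q m.toNat)⁻¹ else 0

lemma poch_mult {q : ℝ} (h0 : 0 < q) (h1 : q < 1) (z : ℝ) :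
    Multipliable (fun j : ℕ => 1 - q ^ j * z) := by
  have : Summable (fun j : ℕ => ‖-(q ^ j * z)‖) := by
    have := ((summable_geometric_of_lt_one h0.le h1).mul_right z).norm
    simpa using this
  simpa [sub_eq_add_neg] using multipliable_one_add_of_summable this

lemma poch_tendsto {q : ℝ} (h0 : 0 < q) (h1 : q < 1) (z : ℝ) :
    Tendsto (fun n => ∏ j ∈ Finset.range n, (1 - q ^ j * z)) atTop (𝓝 (poch z q)) :=
  (poch_mult h0 h1 z).hasProd.tendsto_prod_nat

lemma fac_pos {q : ℝ} (h0 : 0 < q) (h1 : q < 1) (j : ℕ) : 0 < 1 - q ^ j * q := by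
  have : q ^ j * q < 1 := by
    rw [← pow_succ]; exact pow_lt_one₀ h0.le h1 (by simp)
  linarith

lemma poch_ne {q : ℝ} (h0 : 0 < q) (h1 : q < 1) : poch q q ≠ 0 := by
  have hs : Summable (fun j : ℕ => ‖-(q ^ j * q)‖) := by
    have := ((summable_geometric_of_lt_one h0.le h1).mul_right q).norm
    simpa using this
  have := tprod_one_add_ne_zero_of_summable (f := fun j : ℕ => -(q ^ j * q))
    (fun j => by have := fac_pos h0 h1 j; rw [← sub_eq_add_neg]; exact this.ne') hs
  simpa [poch, sub_eq_add_neg] using this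

lemma qf_pos {q : ℝ} (h0 : 0 < q) (h1 : q < 1) (n : ℕ) : 0 < qf q n :=
  Finset.prod_pos fun j _ => fac_pos h0 h1 j

lemma gi_nonneg {q : ℝ} (h0 : 0 < q) (h1 : q < 1) (m : ℤ) : 0 ≤ gi q m := by
  unfold gi; split_ifs
  · exact (inv_pos.2 (qf_pos h0 h1 _)).le
  · exact le_rfl

lemma gi_tendsto {q : ℝ} (h0 : 0 < q) (h1 : q < 1) :
    Tendsto (gi q) atTop (𝓝 (poch q q)⁻¹) := by
  have h : Tendsto (fun n : ℕ => (qf q n)⁻¹) atTop (𝓝 (poch q q)⁻¹) :=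
    (poch_tendsto h0 h1 q).inv₀ (poch_ne h0 h1)
  have h2 : Tendsto Int.toNat atTop atTop := by
    refine tendsto_atTop.2 fun b => ?_
    filter_upwards [eventually_ge_atTop (b : ℤ)] with m hm
    omega
  refine (h.comp h2).congr' ?_
  filter_upwards [eventually_ge_atTop (0 : ℤ)] with m hm
  simp [gi, hm]

lemma gi_bdd {q : ℝ} (h0 : 0 < q) (h1 : q < 1) : ∃ M, ∀ m, gi q m ≤ M := by
  have h : Tendsto (fun n : ℕ => (qf q n)⁻¹) atTop (𝓝 (poch q q)⁻¹) :=
    (poch_tendsto h0 h1 q).inv₀ (poch_ne h0 h1)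
  obtain ⟨M, hM⟩ := h.bddAbove_range
  refine ⟨M, fun m => ?_⟩
  have h3 : ∀ n, (qf q n)⁻¹ ≤ M := fun n => hM ⟨n, rfl⟩
  unfold gi; split_ifs
  · exact h3 _
  · exact (inv_pos.2 (qf_pos h0 h1 0)).le.trans (h3 0)

lemma gi_rec {q : ℝ} (h0 : 0 < q) (h1 : q < 1) (m : ℤ) :
    gi q (m - 1) = (1 - q ^ m) * gi q m := by
  rcases lt_trichotomy m 0 with h | h | h
  · simp [gi, show ¬ (1 ≤ m) by omega, show ¬ (0 ≤ m) by omega]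
  · subst h; simp [gi]
  · obtain ⟨n, rfl⟩ : ∃ n : ℕ, m = n + 1 := ⟨(m - 1).toNat, by omega⟩
    have e1 : ((n : ℤ) + 1).toNat = n + 1 := by omega
    have h2 := qf_pos h0 h1 n
    have h3 := fac_pos h0 h1 n
    have h4 : q ^ ((n : ℤ) + 1) = q ^ n * q := by
      rw [zpow_add₀ h0.ne']; simp
    simp only [gi, add_sub_cancel_right, e1, h4, Int.toNat_natCast, Nat.cast_nonneg, if_true,
      show (0 : ℤ) ≤ n + 1 by omega]
    rw [show qf q (n + 1) = qf q n * (1 - q ^ n * q) from Finset.prod_range_succ _ _]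
    field_simp

/-- finite triple product -/
lemma finite_triple {q : ℝ} (h0 : 0 < q) (h1 : q < 1) {z : ℝ} (hz : 0 < z)
    (e : ℤ → ℝ) (e0 : e 0 = 1) (es : ∀ k, e (k + 1) = - e k * q ^ k * z) (n : ℕ) :
    HasSum (fun k : ℤ => e k * (gi q (n + k) * gi q (n - k)))
      (((∏ j ∈ Finset.range n, (1 - q ^ j * z)) * (∏ j ∈ Finset.range n, (1 - q ^ j * (q / z)))) *
        gi q (2 * n)) := by
  induction n with
  | zero =>
    have := hasSum_single (f := fun k : ℤ => e k * (gi q (((0 : ℕ) : ℤ) + k) * gi q (((0 : ℕ) : ℤ) - k))) 0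
      (fun k hk => by
        rcases lt_or_gt_of_ne hk with h | h
        · simp [gi, show ¬ (0 ≤ k) by omega]
        · simp [gi, show ¬ (k ≤ 0) by omega])
    simpa [e0, gi, qf] using this
  | succ n ih =>
    set F := (∏ j ∈ Finset.range n, (1 - q ^ j * z)) * (∏ j ∈ Finset.range n, (1 - q ^ j * (q / z)))
    set G := gi q (2 * n)
    have hg : G = (1 - q ^ (2 * n + 1)) * (1 - q ^ (2 * n + 2)) * gi q (2 * (n + 1 : ℕ)) := by
      have a1 := gi_rec h0 h1 (2 * (n : ℤ) + 1)
      have a2 := gi_rec h0 h1 (2 * (n : ℤ) + 2)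
      rw [show 2 * (n : ℤ) + 1 - 1 = 2 * n by ring] at a1
      rw [show 2 * (n : ℤ) + 2 - 1 = 2 * n + 1 by ring] at a2
      have b1 : q ^ (2 * (n : ℤ) + 1) = q ^ (2 * n + 1) := by exact_mod_cast zpow_natCast q (2 * n + 1)
      have b2 : q ^ (2 * (n : ℤ) + 2) = q ^ (2 * n + 2) := by exact_mod_cast zpow_natCast q (2 * n + 2)
      simp only [G]
      rw [a1, a2, b1, b2]; push_cast; ring_nf
    have hp : 0 < (1 - q ^ (2 * n + 1)) * (1 - q ^ (2 * n + 2)) := by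
      have := fac_pos h0 h1 (2 * n)
      have := fac_pos h0 h1 (2 * n + 1)
      simp only [← pow_succ] at *
      positivity
    -- three shifted sums
    have s1 := ih.mul_left (1 + q ^ n * q ^ n * q)
    have s2 := ((Equiv.subRight (1 : ℤ)).hasSum_iff.2 ih).mul_left (- (q ^ n * z))
    have s3 := ((Equiv.addRight (1 : ℤ)).hasSum_iff.2 ih).mul_left (- (q ^ n * (q / z)))
    have s := ((s1.add s2).add s3).mul_left ((1 - q ^ (2 * n + 1)) * (1 - q ^ (2 * n + 2)))⁻¹
    refine (congrArg₂ (fun f y => HasSum f y) ?_ ?_).mpr s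
    · funext k
      rw [eq_inv_mul_iff_mul_eq₀ hp.ne']
      simp only [Function.comp, Equiv.subRight_apply, Equiv.coe_addRight]
      have hk : e k = - e (k - 1) * q ^ (k - 1) * z := by
        have := es (k - 1); simpa using this
      have hk0 : q ^ k ≠ 0 := zpow_ne_zero _ h0.ne'
      have hk1 : e (k - 1) = - e k * q / (q ^ k * z) := by
        rw [hk, zpow_sub₀ h0.ne']; field_simp; try simp
      rw [es k, hk1]
      have A : ∀ m : ℤ, gi q (m - 1) = (1 - q ^ m) * gi q m := gi_rec h0 h1
      have c1 : gi q (n + k) = (1 - q ^ n * q * q ^ k) * gi q (n + 1 + k) := by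
        have := A (n + 1 + k)
        rw [show (n : ℤ) + 1 + k - 1 = n + k by ring] at this
        rw [this, zpow_add₀ h0.ne', zpow_add₀ h0.ne']; simp
      have c2 : gi q (n - k) = (1 - q ^ n * q / q ^ k) * gi q (n + 1 - k) := by
        have := A (n + 1 - k)
        rw [show (n : ℤ) + 1 - k - 1 = n - k by ring] at this
        rw [this, zpow_sub₀ h0.ne', zpow_add₀ h0.ne']; simp
      have c3 : gi q (n + (k - 1)) = (1 - q ^ n * q ^ k) * gi q (n + k) := by
        have := A (n + k)
        rw [show (n : ℤ) + k - 1 = n + (k - 1) by ring] at this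
        rw [this, zpow_add₀ h0.ne']; simp
      have c4 : gi q (n - (k + 1)) = (1 - q ^ n / q ^ k) * gi q (n - k) := by
        have := A (n - k)
        rw [show (n : ℤ) - k - 1 = n - (k + 1) by ring] at this
        rw [this, zpow_sub₀ h0.ne']; simp
      rw [show (n : ℤ) - (k - 1) = n + 1 - k by ring, show (n : ℤ) + (k + 1) = n + 1 + k by ring,
        c3, c4, c1, c2]
      push_cast
      generalize gi q (n + 1 + k) = g1
      generalize gi q (n + 1 - k) = g2
      rw [show q ^ (2 * n + 1) = q ^ n * q ^ n * q by ring, show q ^ (2 * n + 2) = q ^ n * q ^ n * q * q by ring]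
      generalize q ^ k = K at *
      generalize q ^ n = N at *
      field_simp
      ring
    · rw [hg, Finset.prod_range_succ, Finset.prod_range_succ, eq_inv_mul_iff_mul_eq₀ hp.ne']
      simp only [F]
      field_simp
      ring

/-- triple product -/
lemma triple {q : ℝ} (h0 : 0 < q) (h1 : q < 1) {z : ℝ} (hz : 0 < z)
    (e : ℤ → ℝ) (e0 : e 0 = 1) (es : ∀ k, e (k + 1) = - e k * q ^ k * z)
    (hs : Summable fun k => |e k|) : theta q z = ∑' k, e k := by
  obtain ⟨M, hM⟩ := gi_bdd h0 h1
  have hM0 : 0 ≤ M := (gi_nonneg h0 h1 0).trans (hM 0)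
  have hg := gi_tendsto h0 h1
  have t1 : Tendsto (fun n : ℕ => ∑' k : ℤ, e k * (gi q (n + k) * gi q (n - k))) atTop
      (𝓝 (∑' k : ℤ, e k * ((poch q q)⁻¹ * (poch q q)⁻¹))) := by
    refine tendsto_tsum_of_dominated_convergence (bound := fun k => |e k| * (M * M))
      (hs.mul_right _) ?_ ?_
    · intro k
      refine Tendsto.const_mul _ (Tendsto.mul ?_ ?_)
      · exact hg.comp (tendsto_atTop_add_const_right _ k tendsto_natCast_atTop_atTop)
      · exact hg.comp (tendsto_atTop_add_const_right _ (-k) tendsto_natCast_atTop_atTop)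
    · refine Eventually.of_forall fun n k => ?_
      rw [norm_mul, Real.norm_eq_abs, Real.norm_eq_abs, abs_of_nonneg
        (mul_nonneg (gi_nonneg h0 h1 _) (gi_nonneg h0 h1 _))]
      exact mul_le_mul_of_nonneg_left (mul_le_mul (hM _) (hM _) (gi_nonneg h0 h1 _) hM0) (abs_nonneg _)
  have t2 : Tendsto (fun n : ℕ => ∑' k : ℤ, e k * (gi q (n + k) * gi q (n - k))) atTop
      (𝓝 ((poch z q * poch (q / z) q) * (poch q q)⁻¹)) := by
    simp_rw [fun n => (finite_triple h0 h1 hz e e0 es n).tsum_eq]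
    refine ((poch_tendsto h0 h1 z).mul (poch_tendsto h0 h1 _)).mul (hg.comp ?_)
    exact tendsto_atTop_mono (fun n : ℕ => (by omega : (n : ℤ) ≤ 2 * (n : ℤ)))
      tendsto_natCast_atTop_atTop
  have := tendsto_nhds_unique t1 t2
  rw [tsum_mul_right] at this
  have hp := poch_ne h0 h1
  field_simp at this
  rw [theta, this]

/-- Gaussian sums over the integers -/
lemma summ_gauss {x : ℝ} (hx0 : 0 < x) (hx1 : x < 1) {s : ℝ} (hs : 0 < s) (v : ℝ) :
    Summable fun k : ℤ => x ^ (s * (v + k) ^ 2) := by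
  have h1 : Summable fun k : ℤ => x ^ (|(k : ℝ)|) := by
    have hg := summable_geometric_of_lt_one hx0.le hx1
    refine Summable.of_nat_of_neg (hg.congr fun n => ?_) (hg.congr fun n => ?_) <;> simp
  refine Summable.of_nonneg_of_le (fun k => (Real.rpow_pos_of_pos hx0 _).le) (fun k => ?_)
    (h1.mul_left (x ^ (-|v| - 1 / (4 * s))))
  rw [← Real.rpow_add hx0]
  refine Real.rpow_le_rpow_of_exponent_ge hx0 hx1.le ?_
  have a1 : |(k : ℝ)| ≤ |v + k| + |v| := by
    have := abs_sub (v + k) v; simpa using this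
  have a2 : |v + k| ≤ s * (v + k) ^ 2 + 1 / (4 * s) := by
    rw [← sq_abs (v + k), ← sub_nonneg]
    have : s * |v + k| ^ 2 + 1 / (4 * s) - |v + k| = s * (|v + k| - 1 / (2 * s)) ^ 2 := by
      field_simp; ring
    rw [this]; positivity
  linarith

def S (x r u : ℝ) : ℝ := ∑' k : ℤ, (-1) ^ k * x ^ ((u + r * (k - 1 / 2)) ^ 2 / r)

lemma summ_S {x : ℝ} (hx0 : 0 < x) (hx1 : x < 1) {r : ℝ} (hr : 0 < r) (u : ℝ) :
    Summable fun k : ℤ => x ^ ((u + r * ((k : ℝ) - 1 / 2)) ^ 2 / r) := by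
  refine (summ_gauss hx0 hx1 hr (u / r - 1 / 2)).congr fun k => ?_
  congr 1; field_simp; ring

lemma summ_S' {x : ℝ} (hx0 : 0 < x) (hx1 : x < 1) {r : ℝ} (hr : 0 < r) (u : ℝ) :
    Summable fun k : ℤ => (-1) ^ k * x ^ ((u + r * ((k : ℝ) - 1 / 2)) ^ 2 / r) := by
  refine ((summ_S hx0 hx1 hr u).congr fun k => ?_).of_norm
  rw [norm_mul, norm_zpow]; simp [abs_of_pos (Real.rpow_pos_of_pos hx0 _)]

lemma bra_eq {x : ℝ} (hx0 : 0 < x) (hx1 : x < 1) {r : ℝ} (hr : 0 < r) (u : ℝ) :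
    bra x r u = x ^ (- r / 4) * S x r u := by
  have hq0 : 0 < x ^ (2 * r) := Real.rpow_pos_of_pos hx0 _
  have hq1 : x ^ (2 * r) < 1 := Real.rpow_lt_one hx0.le hx1 (by linarith)
  have key : ∀ k : ℤ, x ^ (r * k * (k - 1) + 2 * u * k) =
      x ^ (- r / 4 - u ^ 2 / r + u) * x ^ ((u + r * ((k : ℝ) - 1 / 2)) ^ 2 / r) := by
    intro k
    rw [← Real.rpow_add hx0]; congr 1; field_simp; ring
  have h := triple hq0 hq1 (Real.rpow_pos_of_pos hx0 (2 * u))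
    (fun k : ℤ => (-1) ^ k * x ^ (r * k * (k - 1) + 2 * u * k)) (by simp) (by
      intro k
      rw [zpow_add₀ (by norm_num : (-1 : ℝ) ≠ 0), ← Real.rpow_intCast (x ^ (2 * r)), ← Real.rpow_mul hx0.le]
      have : x ^ (r * ((k + 1 : ℤ) : ℝ) * (((k + 1 : ℤ) : ℝ) - 1) + 2 * u * ((k + 1 : ℤ) : ℝ)) =
        x ^ (r * k * (k - 1) + 2 * u * k) * x ^ (2 * r * k) * x ^ (2 * u) := by
        rw [← Real.rpow_add hx0, ← Real.rpow_add hx0]; congr 1; push_cast; ring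
      rw [this]; simp; ring) (by
      simp_rw [key]
      refine ((summ_S hx0 hx1 hr u).mul_left (x ^ (- r / 4 - u ^ 2 / r + u))).congr fun k => ?_
      rw [abs_mul, abs_zpow, abs_mul]; simp [abs_of_pos (Real.rpow_pos_of_pos hx0 _)])
  rw [bra, h, S, ← tsum_mul_left, ← tsum_mul_left]
  refine tsum_congr fun k => ?_
  rw [key]
  have : x ^ (u ^ 2 / r - u) * x ^ (-r / 4 - u ^ 2 / r + u) = x ^ (-r / 4) := by
    rw [← Real.rpow_add hx0]; congr 1; ring
  rw [← this]; ring

lemma S_neg (x r u : ℝ) : S x r (-u) = - S x r u := by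
  rw [S, S, ← tsum_neg, ← (Equiv.subLeft (1 : ℤ)).tsum_eq]
  refine tsum_congr fun k => ?_
  simp only [Equiv.subLeft_apply]
  rw [zpow_sub₀ (by norm_num : (-1 : ℝ) ≠ 0), show (-u + r * (((1 - k : ℤ) : ℝ) - 1 / 2)) ^ 2 = (u + r * ((k : ℝ) - 1 / 2)) ^ 2 by push_cast; ring]
  have : ((-1 : ℝ) ^ k)⁻¹ = (-1) ^ k := by rw [← inv_zpow]; norm_num
  rw [div_eq_mul_inv, this]; simp

def EE (x r u : ℝ) : ℝ := ∑' k : ℤ, x ^ (2 * (u + r * k) ^ 2 / r)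
def OO (x r u : ℝ) : ℝ := ∑' k : ℤ, x ^ (2 * (u + r * (k + 1 / 2)) ^ 2 / r)

lemma summ_E {x : ℝ} (hx0 : 0 < x) (hx1 : x < 1) {r : ℝ} (hr : 0 < r) (u : ℝ) :
    Summable fun k : ℤ => x ^ (2 * (u + r * (k : ℝ)) ^ 2 / r) := by
  refine (summ_gauss hx0 hx1 (by positivity : 0 < 2 * r) (u / r)).congr fun k => ?_
  congr 1; field_simp

lemma summ_O {x : ℝ} (hx0 : 0 < x) (hx1 : x < 1) {r : ℝ} (hr : 0 < r) (u : ℝ) :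
    Summable fun k : ℤ => x ^ (2 * (u + r * ((k : ℝ) + 1 / 2)) ^ 2 / r) := by
  refine (summ_gauss hx0 hx1 (by positivity : 0 < 2 * r) (u / r + 1 / 2)).congr fun k => ?_
  congr 1; field_simp; ring

lemma hasSum_mul {f g : ℤ → ℝ} (hf : Summable f) (hg : Summable g) (hf0 : ∀ k, 0 ≤ f k)
    (hg0 : ∀ k, 0 ≤ g k) : HasSum (fun p : ℤ × ℤ => f p.1 * g p.2) ((∑' k, f k) * ∑' k, g k) :=
  hf.hasSum.mul hg.hasSum (hf.mul_of_nonneg hg hf0 hg0)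

lemma hasSum_split (F : ℤ × ℤ → ℝ) {A B : ℝ}
    (h1 : HasSum (fun p : ℤ × ℤ => F (p.1 + p.2 + 1, p.1 - p.2 + 1)) A)
    (h2 : HasSum (fun p : ℤ × ℤ => F (p.1 + p.2 + 1, p.1 - p.2)) B) : HasSum F (A + B) := by
  let φ : ℤ × ℤ → ℤ × ℤ := fun p => (p.1 + p.2 + 1, p.1 - p.2 + 1)
  let ψ : ℤ × ℤ → ℤ × ℤ := fun p => (p.1 + p.2 + 1, p.1 - p.2)
  have hφ : Function.Injective φ := by
    rintro ⟨a, b⟩ ⟨c, d⟩ h; simp only [φ, Prod.mk.injEq] at h ⊢; omega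
  have hψ : Function.Injective ψ := by
    rintro ⟨a, b⟩ ⟨c, d⟩ h; simp only [ψ, Prod.mk.injEq] at h ⊢; omega
  have hc : IsCompl (Set.range φ) (Set.range ψ) := by
    constructor
    · rw [Set.disjoint_left]
      rintro _ ⟨⟨a, b⟩, rfl⟩ ⟨⟨c, d⟩, h⟩
      simp only [φ, ψ, Prod.mk.injEq] at h; omega
    · rw [codisjoint_iff_le_sup]
      rintro ⟨m, n⟩ -
      rcases Int.even_or_odd' (m + n) with ⟨c, hc | hc⟩
      · left; exact ⟨(c - 1, m - c), by simp only [φ, Prod.mk.injEq]; omega⟩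
      · right; exact ⟨(c, m - c - 1), by simp only [ψ, Prod.mk.injEq]; omega⟩
  exact HasSum.add_isCompl hc ((hφ.hasSum_range_iff (f := F)).2 h1) ((hψ.hasSum_range_iff (f := F)).2 h2)

lemma mul_split {f g f1 g1 f2 g2 : ℤ → ℝ} (hf : Summable f) (hg : Summable g)
    (hf1 : Summable f1) (hg1 : Summable g1) (hf2 : Summable f2) (hg2 : Summable g2)
    (e1 : ∀ i j : ℤ, f (i + j + 1) * g (i - j + 1) = f1 i * g1 j)
    (e2 : ∀ i j : ℤ, f (i + j + 1) * g (i - j) = -(f2 i * g2 j)) :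
    (∑' k, f k) * (∑' k, g k) = (∑' k, f1 k) * (∑' k, g1 k) - (∑' k, f2 k) * (∑' k, g2 k) := by
  have H : ∀ {f g : ℤ → ℝ}, Summable f → Summable g →
      HasSum (fun p : ℤ × ℤ => f p.1 * g p.2) ((∑' k, f k) * ∑' k, g k) := fun hf hg =>
    hf.hasSum.mul hg.hasSum (summable_mul_of_summable_norm hf.norm hg.norm)
  have h1 := H hf1 hg1
  have h2 := (H hf2 hg2).neg
  simp only [← e1] at h1
  simp only [← e2] at h2
  rw [sub_eq_add_neg]
  exact (H hf hg).unique (hasSum_split (fun p : ℤ × ℤ => f p.1 * g p.2) h1 h2)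

lemma S_mul {x : ℝ} (hx0 : 0 < x) (hx1 : x < 1) {r : ℝ} (hr : 0 < r) (u v : ℝ) :
    S x r (u + v) * S x r (u - v) = OO x r u * EE x r v - EE x r u * OO x r v := by
  have m1 : ∀ k : ℤ, ((-1 : ℝ) ^ k) * (-1) ^ k = 1 := fun k => by
    rw [← mul_zpow]; norm_num
  have m0 : (-1 : ℝ) ≠ 0 := by norm_num
  refine mul_split (summ_S' hx0 hx1 hr (u + v)) (summ_S' hx0 hx1 hr (u - v)) (summ_O hx0 hx1 hr u)
    (summ_E hx0 hx1 hr v) (summ_E hx0 hx1 hr u) (summ_O hx0 hx1 hr v) (fun i j => ?_) (fun i j => ?_)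
  · rw [mul_mul_mul_comm, ← Real.rpow_add hx0, ← Real.rpow_add hx0, ← zpow_add₀ m0,
      show i + j + 1 + (i - j + 1) = (i + 1) + (i + 1) by ring, zpow_add₀ m0, m1, one_mul]
    congr 1; push_cast; field_simp; ring
  · rw [mul_mul_mul_comm, ← Real.rpow_add hx0, ← Real.rpow_add hx0, ← zpow_add₀ m0,
      show i + j + 1 + (i - j) = i + i + 1 by ring, zpow_add₀ m0, zpow_add₀ m0, m1, one_mul,
      zpow_one, neg_one_mul]
    congr 2; push_cast; field_simp; ring

lemma S_three {x : ℝ} (hx0 : 0 < x) (hx1 : x < 1) {r : ℝ} (hr : 0 < r) (a b c d : ℝ) :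
    S x r (a + b) * S x r (a - b) * (S x r (c + d) * S x r (c - d))
    - S x r (a + c) * S x r (a - c) * (S x r (b + d) * S x r (b - d))
    + S x r (a + d) * S x r (a - d) * (S x r (b + c) * S x r (b - c)) = 0 := by
  simp only [S_mul hx0 hx1 hr]; ring

lemma bra_three {x : ℝ} (hx0 : 0 < x) (hx1 : x < 1) {r : ℝ} (hr : 0 < r) (a b c d : ℝ) :
    bra x r (a + b) * bra x r (a - b) * (bra x r (c + d) * bra x r (c - d))
    - bra x r (a + c) * bra x r (a - c) * (bra x r (b + d) * bra x r (b - d))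
    + bra x r (a + d) * bra x r (a - d) * (bra x r (b + c) * bra x r (b - c)) = 0 := by
  simp only [bra_eq hx0 hx1 hr]
  linear_combination (x ^ (-r / 4)) ^ 4 * S_three hx0 hx1 hr a b c d

lemma bra_neg {x : ℝ} (hx0 : 0 < x) (hx1 : x < 1) {r : ℝ} (hr : 0 < r) (u : ℝ) :
    bra x r (-u) = - bra x r u := by
  rw [bra_eq hx0 hx1 hr, bra_eq hx0 hx1 hr, S_neg]; ring

end

/-- Weierstrass three-term relation -/
def Three (s : ℝ → ℝ) : Prop := ∀ a b c d : ℝ,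
    s (a + b) * s (a - b) * (s (c + d) * s (c - d))
    - s (a + c) * s (a - c) * (s (b + d) * s (b - d))
    + s (a + d) * s (a - d) * (s (b + c) * s (b - c)) = 0

lemma three_gen {s : ℝ → ℝ} (H : Three s) (a b c d x1 x2 x3 x4 x5 x6 x7 x8 x9 x10 x11 x12 : ℝ)
    (h1 : a + b = x1 := by ring) (h2 : a - b = x2 := by ring) (h3 : c + d = x3 := by ring)
    (h4 : c - d = x4 := by ring) (h5 : a + c = x5 := by ring) (h6 : a - c = x6 := by ring)
    (h7 : b + d = x7 := by ring) (h8 : b - d = x8 := by ring) (h9 : a + d = x9 := by ring)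
    (h10 : a - d = x10 := by ring) (h11 : b + c = x11 := by ring) (h12 : b - c = x12 := by ring) :
    s x1 * s x2 * (s x3 * s x4) - s x5 * s x6 * (s x7 * s x8)
      + s x9 * s x10 * (s x11 * s x12) = 0 := by
  subst_vars; exact H a b c d

/-- the common shape of the off-diagonal weights -/
def wt (s : ℝ → ℝ) (R u m n l : ℝ) : ℝ := R * (s m * s n) / (s (u - 1) * s l)

/-- the data under which the theta-function identities below are stated -/
structure IC (s : ℝ → ℝ) (A B u w : ℝ) : Prop where
  H : Three s
  odd : ∀ v, s (-v) = - s v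
  hu : s (u - 1) ≠ 0
  hw : s (w - 1) ≠ 0
  huw : s (u + w - 1) ≠ 0
  hA : s A ≠ 0
  hA1 : s (A + 1) ≠ 0
  hB : s B ≠ 0
  hAB : s (A + B) ≠ 0

lemma fin1 {P X Y : ℝ} (K : ℝ) (hP : P = 0) (h : X - Y = K * P) : X = Y := by
  rw [hP, mul_zero] at h; exact sub_eq_zero.mp h

lemma fin2 {P Q X Y : ℝ} (K L : ℝ) (hP : P = 0) (hQ : Q = 0) (h : X - Y = K * P + L * Q) :
    X = Y := by
  rw [hP, hQ, mul_zero, mul_zero, add_zero] at h; exact sub_eq_zero.mp h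

section
variable {s : ℝ → ℝ} {A B u w : ℝ}

lemma id_ppq_ppq (C : IC s A B u w) (R1 R2 R3 : ℝ) :
    wt s (-R1) (u + w) (u + w + A + 1) 1 (A + 1) * R2 * R3 + 0 + 0
      = R1 * wt s (-R2) u (u + A + 1) 1 (A + 1) * wt s (-R3) w (w + A + 1) 1 (A + 1) + wt s (-R1) (u + w) (u + w + A) 1 A * wt s R2 u u A (A + 1) * wt s R3 w w (A + 2) (A + 1) + 0 := by
  obtain ⟨H, odd, hu, hw, huw, hA, hA1, hB, hAB⟩ := C
  refine fin1 (-(R1 * R2 * R3 / (s (u - 1) * s (w - 1) * s (u + w - 1)) * (s 1) / (s (A + 1) ^ 2))) (three_gen H (u / 2 + A / 2) (-u / 2 + A / 2 + 1) (u / 2 + w + A / 2) (-u / 2 - A / 2 - 1)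
    (A + 1) (u - 1) (w - 1) (u + w + A + 1) (u + w + A) (-w) (-u) (A + 2) (-1) (u + A + 1) (w + A + 1) (-(u + w - 1))) ?_
  simp only [wt, odd]
  field_simp
  ring

lemma id_ppq_pqp (C : IC s A B u w) (R1 R2 R3 : ℝ) :
    wt s R1 (u + w) (u + w) A (A + 1) * wt s (-R2) u (u + A) 1 A * R3 + 0 + 0
      = R1 * wt s (-R2) u (u + A + 1) 1 (A + 1) * wt s R3 w w A (A + 1) + wt s (-R1) (u + w) (u + w + A) 1 A * wt s R2 u u A (A + 1) * wt s R3 w (w - A - 1) 1 (A + 1) + 0 := by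
  obtain ⟨H, odd, hu, hw, huw, hA, hA1, hB, hAB⟩ := C
  refine fin1 (-(R1 * R2 * R3 / (s (u - 1) * s (w - 1) * s (u + w - 1)) * (s 1) / (s (A + 1) ^ 2))) (three_gen H (u / 2 + A + 1 / 2) (-u / 2 + 1 / 2) (u / 2 + w - 1 / 2) (-u / 2 - 1 / 2)
    (A + 1) (u + A) (w - 1) (u + w) (u + w + A) (-(w - A - 1)) (-u) 1 A (u + A + 1) w (-(u + w - 1))) ?_
  simp only [wt, odd]
  field_simp
  ring

lemma id_ppq_qpp (C : IC s A B u w) (R1 R2 R3 : ℝ) :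
    wt s R1 (u + w) (u + w) A (A + 1) * wt s R2 u u (A - 1) A * R3 + 0 + 0
      = 0 + wt s R1 (u + w) (u + w) (A - 1) A * wt s R2 u u A (A + 1) * R3 + 0 := by
  obtain ⟨H, odd, hu, hw, huw, hA, hA1, hB, hAB⟩ := C
  simp only [wt]
  field_simp
  try ring

lemma id_pqp_ppq (C : IC s A B u w) (R1 R2 R3 : ℝ) :
    wt s R1 (u + w) (u + w) (A + 2) (A + 1) * R2 * wt s (-R3) w (w + A) 1 A + 0 + 0
      = R1 * wt s R2 u u (A + 2) (A + 1) * wt s (-R3) w (w + A + 1) 1 (A + 1) + wt s (-R1) (u + w) (u + w + A) 1 A * wt s R2 u (u - A - 1) 1 (A + 1) * wt s R3 w w (A + 2) (A + 1) + 0 := by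
  obtain ⟨H, odd, hu, hw, huw, hA, hA1, hB, hAB⟩ := C
  refine fin1 (-(R1 * R2 * R3 / (s (u - 1) * s (w - 1) * s (u + w - 1)) * (s 1 * s (A + 2)) / (s A * s (A + 1) ^ 2))) (three_gen H (u / 2 + A / 2) (-u / 2 + A / 2 + 1) (u / 2 + w + A / 2) (-u / 2 + A / 2)
    (A + 1) (u - 1) (w + A) (u + w) (u + w + A) (-w) (-(u - A - 1)) 1 A u (w + A + 1) (-(u + w - 1))) ?_
  simp only [wt, odd]
  field_simp
  ring

lemma id_pqp_pqp (C : IC s A B u w) (R1 R2 R3 : ℝ) :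
    wt s R1 (u + w) (u + w - A - 1) 1 (A + 1) * wt s (-R2) u (u + A) 1 A * wt s (-R3) w (w + A) 1 A + R1 * wt s R2 u u (A + 1) A * wt s R3 w w (A - 1) A + 0
      = R1 * wt s R2 u u (A + 2) (A + 1) * wt s R3 w w A (A + 1) + wt s (-R1) (u + w) (u + w + A) 1 A * wt s R2 u (u - A - 1) 1 (A + 1) * wt s R3 w (w - A - 1) 1 (A + 1) + 0 := by
  obtain ⟨H, odd, hu, hw, huw, hA, hA1, hB, hAB⟩ := C
  refine fin2 ((R1 * R2 * R3 / (s (u - 1) * s (w - 1) * s (u + w - 1)) * (s 1 ^ 3) / (s A ^ 2 * s (A + 1) ^ 2)))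
    ((R1 * R2 * R3 / (s (u - 1) * s (w - 1) * s (u + w - 1)) * (s w * s u * s (u + w - 1)) / (s A ^ 2 * s (A + 1) ^ 2)))
    (three_gen H (u / 2 + w / 2) (-u / 2 - w / 2 + A + 1) (u / 2 + w / 2 + A) (u / 2 - w / 2)
    (A + 1) (u + w - A - 1) (u + A) (w + A) (u + w + A) (-A) (-(w - A - 1)) (-(u - A - 1)) u w (2 * A + 1) (-(u + w - 1)))
    (three_gen H (A + 1) 0 A 1
    (A + 1) (A + 1) (A + 1) (A - 1) (2 * A + 1) 1 1 (-1) (A + 2) A A (-A)) ?_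
  simp only [wt, odd]
  field_simp
  ring

lemma id_pqp_qpp (C : IC s A B u w) (R1 R2 R3 : ℝ) :
    wt s R1 (u + w) (u + w - A - 1) 1 (A + 1) * wt s R2 u u (A - 1) A * wt s (-R3) w (w + A) 1 A + R1 * wt s R2 u (u - A) 1 A * wt s R3 w w (A - 1) A + 0
      = 0 + wt s R1 (u + w) (u + w) (A - 1) A * wt s R2 u (u - A - 1) 1 (A + 1) * R3 + 0 := by
  obtain ⟨H, odd, hu, hw, huw, hA, hA1, hB, hAB⟩ := C
  refine fin1 (-(R1 * R2 * R3 / (s (u - 1) * s (w - 1) * s (u + w - 1)) * (s 1 * s (A - 1)) / (s A ^ 2 * s (A + 1)))) (three_gen H (u / 2 + w - 1 / 2) (-u / 2 + A + 1 / 2) (u / 2 + 1 / 2) (u / 2 - 1 / 2)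
    (w + A) (u + w - A - 1) u 1 (u + w) (w - 1) A (-(u - A - 1)) (u + w - 1) w (A + 1) (-(u - A))) ?_
  simp only [wt, odd]
  field_simp
  ring

lemma id_qpp_ppq (C : IC s A B u w) (R1 R2 R3 : ℝ) :
    wt s R1 (u + w) (u + w) (A + 2) (A + 1) * R2 * wt s R3 w w (A + 1) A + 0 + 0
      = wt s R1 (u + w) (u + w) (A + 1) A * R2 * wt s R3 w w (A + 2) (A + 1) + 0 + 0 := by
  obtain ⟨H, odd, hu, hw, huw, hA, hA1, hB, hAB⟩ := C
  simp only [wt]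
  field_simp
  try ring

lemma id_qpp_pqp (C : IC s A B u w) (R1 R2 R3 : ℝ) :
    wt s R1 (u + w) (u + w - A - 1) 1 (A + 1) * wt s (-R2) u (u + A) 1 A * wt s R3 w w (A + 1) A + R1 * wt s R2 u u (A + 1) A * wt s R3 w (w - A) 1 A + 0
      = wt s R1 (u + w) (u + w) (A + 1) A * R2 * wt s R3 w (w - A - 1) 1 (A + 1) + 0 + 0 := by
  obtain ⟨H, odd, hu, hw, huw, hA, hA1, hB, hAB⟩ := C
  refine fin1 (-(R1 * R2 * R3 / (s (u - 1) * s (w - 1) * s (u + w - 1)) * (s 1) / (s A ^ 2))) (three_gen H (u / 2 + w / 2 - A / 2) (-u / 2 - w / 2 + A / 2 + 1) (u / 2 + w / 2 + A / 2) (u / 2 - w / 2 + A / 2)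
    1 (u + w - A - 1) (u + A) w (u + w) (-A) (-(w - A - 1)) (-(u - 1)) u (w - A) (A + 1) (-(u + w - 1))) ?_
  simp only [wt, odd]
  field_simp
  ring

lemma id_qpp_qpp (C : IC s A B u w) (R1 R2 R3 : ℝ) :
    wt s R1 (u + w) (u + w - A - 1) 1 (A + 1) * wt s R2 u u (A - 1) A * wt s R3 w w (A + 1) A + R1 * wt s R2 u (u - A) 1 A * wt s R3 w (w - A) 1 A + 0
      = wt s R1 (u + w) (u + w - A) 1 A * R2 * R3 + 0 + 0 := by
  obtain ⟨H, odd, hu, hw, huw, hA, hA1, hB, hAB⟩ := C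
  refine fin1 ((R1 * R2 * R3 / (s (u - 1) * s (w - 1) * s (u + w - 1)) * (s 1) / (s A ^ 2))) (three_gen H (u / 2 + w / 2 - 1) (-u / 2 - w / 2 + A) (u / 2 + w / 2) (-u / 2 + w / 2)
    (A - 1) (u + w - A - 1) w u (u + w - 1) (-1) (-(u - A)) (-(w - A)) (w - 1) (u - 1) A (-(u + w - A))) ?_
  simp only [wt, odd]
  field_simp
  ring

lemma id_pqt_pqt (C : IC s A B u w) (R1 R2 R3 : ℝ) :
    wt s (-R1) (u + w) (u + w + B) 1 B * wt s (-R2) u (u + A) 1 A * wt s (-R3) w (w + A) 1 A + wt s (-R1) (u + w) (u + w + A + B) 1 (A + B) * wt s R2 u u (A + 1) A * wt s R3 w w (A - 1) A + 0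
      = 0 + wt s (-R1) (u + w) (u + w + A) 1 A * wt s (-R2) u (u + B) 1 B * wt s (-R3) w (w + B) 1 B + wt s (-R1) (u + w) (u + w + A + B) 1 (A + B) * wt s R2 u u (B - 1) B * wt s R3 w w (B + 1) B := by
  obtain ⟨H, odd, hu, hw, huw, hA, hA1, hB, hAB⟩ := C
  refine fin2 (-(R1 * R2 * R3 / (s (u - 1) * s (w - 1) * s (u + w - 1)) * (s 1 ^ 3 * s (A + B)) / (s B ^ 2 * s A ^ 2 * s (A + B))))
    (-(R1 * R2 * R3 / (s (u - 1) * s (w - 1) * s (u + w - 1)) * (s 1 * s w * s u * s (u + w + A + B)) / (s B ^ 2 * s A ^ 2 * s (A + B))))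
    (three_gen H (u + w / 2 + A / 2 + B / 2) (w / 2 - A / 2 + B / 2) (w / 2 + A / 2 + B / 2) (-w / 2 - A / 2 + B / 2)
    (u + w + B) (u + A) B (w + A) (u + w + A + B) u (-(A - B)) w (u + B) (u + w + A) (w + B) (-A))
    (three_gen H (A / 2 + B / 2 + 1 / 2) (A / 2 - B / 2 + 1 / 2) (A / 2 + B / 2 - 1 / 2) (-A / 2 + B / 2 + 1 / 2)
    (A + 1) B B (A - 1) (A + B) 1 1 (A - B) (B + 1) A A (-(B - 1))) ?_
  simp only [wt, odd]
  field_simp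
  ring

lemma id_pqt_ptq (C : IC s A B u w) (R1 R2 R3 : ℝ) :
    wt s R1 (u + w) (u + w) (B - 1) B * wt s (-R2) u (u + A + B) 1 (A + B) * wt s (-R3) w (w + A) 1 A + 0 + 0
      = 0 + wt s (-R1) (u + w) (u + w + A) 1 A * wt s (-R2) u (u + B) 1 B * wt s R3 w w (B - 1) B + wt s (-R1) (u + w) (u + w + A + B) 1 (A + B) * wt s R2 u u (B - 1) B * wt s R3 w (w - B) 1 B := by
  obtain ⟨H, odd, hu, hw, huw, hA, hA1, hB, hAB⟩ := C
  refine fin1 ((R1 * R2 * R3 / (s (u - 1) * s (w - 1) * s (u + w - 1)) * (s 1 ^ 2 * s (B - 1)) / (s B ^ 2 * s A * s (A + B)))) (three_gen H (u / 2 + A / 2 + B) (u / 2 + A / 2) (u / 2 + w + A / 2) (-u / 2 + A / 2)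
    (u + A + B) B (w + A) (u + w) (u + w + A + B) (-(w - B)) A u (A + B) (u + B) (u + w + A) (-w)) ?_
  simp only [wt, odd]
  field_simp
  ring

lemma id_pqt_qpt (C : IC s A B u w) (R1 R2 R3 : ℝ) :
    wt s (-R1) (u + w) (u + w + B) 1 B * wt s R2 u u (A - 1) A * wt s (-R3) w (w + A) 1 A + wt s (-R1) (u + w) (u + w + A + B) 1 (A + B) * wt s R2 u (u - A) 1 A * wt s R3 w w (A - 1) A + 0
      = 0 + wt s R1 (u + w) (u + w) (A - 1) A * wt s (-R2) u (u + B) 1 B * wt s (-R3) w (w + A + B) 1 (A + B) + 0 := by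
  obtain ⟨H, odd, hu, hw, huw, hA, hA1, hB, hAB⟩ := C
  refine fin1 ((R1 * R2 * R3 / (s (u - 1) * s (w - 1) * s (u + w - 1)) * (s 1 ^ 2 * s (A - 1)) / (s B * s A ^ 2 * s (A + B)))) (three_gen H (u / 2 + w / 2 + A / 2 + B) (u / 2 + w / 2 - A / 2) (u / 2 + w / 2 + A / 2) (u / 2 - w / 2 - A / 2)
    (u + w + B) (A + B) u (w + A) (u + w + A + B) B (u - A) w (u + B) (w + A + B) (u + w) (-A)) ?_
  simp only [wt, odd]
  field_simp
  ring

lemma id_pqt_qtp (C : IC s A B u w) (R1 R2 R3 : ℝ) :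
    0 + wt s R1 (u + w) (u + w) (A + B - 1) (A + B) * wt s (-R2) u (u + B) 1 B * wt s R3 w w (A - 1) A + 0
      = 0 + wt s R1 (u + w) (u + w) (A - 1) A * wt s (-R2) u (u + B) 1 B * wt s R3 w w (A + B - 1) (A + B) + 0 := by
  obtain ⟨H, odd, hu, hw, huw, hA, hA1, hB, hAB⟩ := C
  simp only [wt]
  field_simp
  try ring

lemma id_pqt_tpq (C : IC s A B u w) (R1 R2 R3 : ℝ) :
    wt s R1 (u + w) (u + w) (B - 1) B * wt s R2 u u (A + B - 1) (A + B) * wt s (-R3) w (w + A) 1 A + 0 + 0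
      = 0 + 0 + wt s R1 (u + w) (u + w) (A + B - 1) (A + B) * wt s R2 u u (B - 1) B * wt s (-R3) w (w + A) 1 A := by
  obtain ⟨H, odd, hu, hw, huw, hA, hA1, hB, hAB⟩ := C
  simp only [wt]
  field_simp
  try ring

lemma id_pqt_tqp (C : IC s A B u w) (R1 R2 R3 : ℝ) :
    0 + wt s R1 (u + w) (u + w) (A + B - 1) (A + B) * wt s R2 u u (B - 1) B * wt s R3 w w (A - 1) A + 0
      = 0 + 0 + wt s R1 (u + w) (u + w) (A + B - 1) (A + B) * wt s R2 u u (B - 1) B * wt s R3 w w (A - 1) A := by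
  obtain ⟨H, odd, hu, hw, huw, hA, hA1, hB, hAB⟩ := C
  simp only [wt]
  field_simp
  try ring

end

lemma epsbar_apply (μ k : Fin 3) : epsbar μ k = (if k = μ then 1 else 0) - 1 / 3 := by
  simp only [epsbar, eps, Pi.sub_apply, Pi.smul_apply, Pi.add_apply, smul_eq_mul]
  fin_cases k <;> simp

lemma epsbar_inj {μ ν : Fin 3} (h : epsbar μ = epsbar ν) : μ = ν := by
  by_contra hn
  have := congrFun h μ
  simp [epsbar_apply, hn] at this

lemma idx_epsbar (μ : Fin 3) : idx (epsbar μ) = some μ := by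
  have h : ∃ ν : Fin 3, epsbar μ = epsbar ν := ⟨μ, rfl⟩
  rw [idx, dif_pos h, ← epsbar_inj h.choose_spec]

lemma idx_some {v : V} {μ : Fin 3} (h : idx v = some μ) : v = epsbar μ := by
  unfold idx at h
  split_ifs at h with h1
  rw [Option.some.injEq] at h
  rw [← h]; exact h1.choose_spec

lemma idx_step {v w : V} {μ : Fin 3} (h : v = w + epsbar μ) : idx (v - w) = some μ := by
  rw [h, add_sub_cancel_left, idx_epsbar]

/-- two-step paths with common endpoints -/
lemma two_step {p q p' q' : Fin 3} (h : epsbar p + epsbar q = epsbar p' + epsbar q') :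
    (p' = p ∧ q' = q) ∨ (p' = q ∧ q' = p) := by
  have h0 := congrFun h 0
  have h1 := congrFun h 1
  have h2 := congrFun h 2
  simp only [Pi.add_apply, epsbar_apply] at h0 h1 h2
  revert h0 h1 h2
  clear h
  fin_cases p <;> fin_cases q <;> fin_cases p' <;> fin_cases q' <;> norm_num

lemma htd_add (a : V) (κ μ ν : Fin 3) :
    htd (a + epsbar κ) μ ν = htd a μ ν + ((if κ = μ then 1 else 0) - (if κ = ν then 1 else 0)) := by
  simp only [htd, ht, ip, Fin.sum_univ_three, Pi.add_apply, epsbar_apply]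
  fin_cases κ <;> fin_cases μ <;> fin_cases ν <;> simp <;> ring

lemma htd_swap (a : V) (μ ν : Fin 3) : htd a μ ν = - htd a ν μ := by simp [htd]

lemma htd_trans (a : V) (p q t : Fin 3) : htd a p t = htd a p q + htd a q t := by simp [htd]

lemma ws_none {x r : ℝ} {a b c d : V} {u : ℝ}
    (h : WS x r a b c d u ≠ 0) : ∃ p q p' q' : Fin 3, b = d + epsbar p ∧ a = b + epsbar q ∧
      c = d + epsbar p' ∧ a = c + epsbar q' := by
  unfold WS at h
  split at h
  · rename_i p q p' q' h1 h2 h3 h4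
    refine ⟨p, q, p', q', ?_, ?_, ?_, ?_⟩
    · rw [← idx_some h1]; abel
    · rw [← idx_some h2]; abel
    · rw [← idx_some h3]; abel
    · rw [← idx_some h4]; abel
  · exact absurd rfl h

lemma ws_zero {x r : ℝ} {a b c d : V} {u : ℝ} {p q p' : Fin 3} (n1 : p' ≠ p) (n2 : p' ≠ q)
    (h1 : b = d + epsbar p := by abel) (h2 : a = b + epsbar q := by abel)
    (h3 : c = d + epsbar p' := by abel) : WS x r a b c d u = 0 := by
  by_contra h
  obtain ⟨_, _, _, q', -, -, -, h4⟩ := ws_none h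
  have : epsbar p + epsbar q = epsbar p' + epsbar q' := by
    rw [h2, h1, h3, add_assoc, add_assoc] at h4; exact add_left_cancel h4
  rcases two_step this with ⟨h, -⟩ | ⟨h, -⟩
  · exact n1 h
  · exact n2 h

lemma ws_zero' {x r : ℝ} {a b c d : V} {u : ℝ} {p q p' : Fin 3} (n1 : p' ≠ p) (n2 : p' ≠ q)
    (h1 : c = d + epsbar p := by abel) (h2 : a = c + epsbar q := by abel)
    (h3 : b = d + epsbar p' := by abel) : WS x r a b c d u = 0 := by
  by_contra h
  obtain ⟨_, q', _, _, -, h4, -, -⟩ := ws_none h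
  have : epsbar p + epsbar q = epsbar p' + epsbar q' := by
    rw [h2, h1, h3, add_assoc, add_assoc] at h4; exact add_left_cancel h4
  rcases two_step this with ⟨h, -⟩ | ⟨h, -⟩
  · exact n1 h
  · exact n2 h

lemma ws_diag {x r : ℝ} {a b c d : V} {u : ℝ} (p : Fin 3)
    (h1 : b = d + epsbar p := by abel) (h2 : a = b + epsbar p := by abel)
    (h3 : c = d + epsbar p := by abel) : WS x r a b c d u = r1S x r u := by
  have h4 : a = c + epsbar p := by rw [h2, h1, h3]
  unfold WS
  rw [idx_step h1, idx_step h2, idx_step h3, idx_step h4]; simp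

lemma ws_swap {x r : ℝ} {a b c d : V} {u l n : ℝ} {p q : Fin 3} (hpq : p ≠ q)
    (h1 : b = d + epsbar p := by abel) (h2 : a = b + epsbar q := by abel)
    (h3 : c = d + epsbar q := by abel)
    (hl : htd d p q = l := by simp [htd_add, *]) (hn : n = l - 1 := by ring) :
    WS x r a b c d u = wt (braS x r) (r1S x r u) u u n l := by
  have h4 : a = c + epsbar p := by rw [h2, h1, h3]; abel
  unfold WS
  rw [idx_step h1, idx_step h2, idx_step h3, idx_step h4]; simp [wt, hpq, hpq.symm, hl, hn]

lemma ws_swap' {x r : ℝ} (odd : ∀ v, braS x r (-v) = - braS x r v) {a b c d : V} {u l n : ℝ}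
    {p q : Fin 3} (hpq : p ≠ q)
    (h1 : b = d + epsbar p := by abel) (h2 : a = b + epsbar q := by abel)
    (h3 : c = d + epsbar q := by abel)
    (hl : htd d q p = l := by simp [htd_add, *]) (hn : n = l + 1 := by ring) :
    WS x r a b c d u = wt (braS x r) (r1S x r u) u u n l := by
  rw [ws_swap (l := -l) (n := -n) hpq h1 h2 h3 (by rw [htd_swap, hl]) (by rw [hn]; ring)]
  simp only [wt, odd, mul_neg, neg_div_neg_eq]

lemma ws_id' {x r : ℝ} {a b c d : V} {u l n : ℝ} {p q : Fin 3} (hpq : p ≠ q)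
    (h1 : b = d + epsbar p := by abel) (h2 : a = b + epsbar q := by abel)
    (h3 : c = d + epsbar p := by abel)
    (hl : htd d q p = l := by simp [htd_add, *]) (hn : n = u - l := by ring) :
    WS x r a b c d u = wt (braS x r) (r1S x r u) u n 1 l := by
  have h4 : a = c + epsbar q := by rw [h2, h1, h3]
  unfold WS
  rw [idx_step h1, idx_step h2, idx_step h3, idx_step h4]; simp [wt, hpq, hpq.symm, hl, hn]

lemma ws_id {x r : ℝ} (odd : ∀ v, braS x r (-v) = - braS x r v) {a b c d : V} {u l n : ℝ}
    {p q : Fin 3} (hpq : p ≠ q)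
    (h1 : b = d + epsbar p := by abel) (h2 : a = b + epsbar q := by abel)
    (h3 : c = d + epsbar p := by abel)
    (hl : htd d p q = l := by simp [htd_add, *]) (hn : n = u + l := by ring) :
    WS x r a b c d u = wt (braS x r) (-r1S x r u) u n 1 l := by
  rw [ws_id' (l := -l) (n := n) hpq h1 h2 h3 (by rw [htd_swap, hl]) (by rw [hn]; ring)]
  simp only [wt, odd, mul_neg, div_neg, neg_div, neg_mul]

/-- summand on the left-hand side -/
def LT (x r : ℝ) (a b c d e f : V) (u w : ℝ) (κ : Fin 3) : ℝ :=
  WS x r d e c (a + epsbar κ) (u + w) * WS x r c (a + epsbar κ) b a u *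
    WS x r e f (a + epsbar κ) a w

/-- summand on the right-hand side -/
def RT (x r : ℝ) (a b c d e f : V) (u w : ℝ) (κ : Fin 3) : ℝ :=
  WS x r (f + epsbar κ) f b a (u + w) * WS x r d e (f + epsbar κ) f u *
    WS x r d (f + epsbar κ) c b w

lemma sum3 {p q t : Fin 3} (hpq : p ≠ q) (hpt : p ≠ t) (hqt : q ≠ t) (F : Fin 3 → ℝ) :
    ∑ κ, F κ = F p + F q + F t := by
  rw [Fin.sum_univ_three]
  revert hpq hpt hqt
  fin_cases p <;> fin_cases q <;> fin_cases t <;> simp <;> ring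


/-- the Yang-Baxter equation along the paths `i₁ i₂ i₃` and `j₁ j₂` from `a` -/
def Y (x r u w : ℝ) (a : V) (i₁ i₂ i₃ j₁ j₂ : Fin 3) : Prop :=
  ∑ κ, LT x r a (a + epsbar j₁) (a + epsbar j₁ + epsbar j₂)
      (a + epsbar i₁ + epsbar i₂ + epsbar i₃) (a + epsbar i₁ + epsbar i₂) (a + epsbar i₁) u w κ =
  ∑ κ, RT x r a (a + epsbar j₁) (a + epsbar j₁ + epsbar j₂)
      (a + epsbar i₁ + epsbar i₂ + epsbar i₃) (a + epsbar i₁ + epsbar i₂) (a + epsbar i₁) u w κ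

/-- three distinct directions together with the non-vanishing conditions -/
structure Ctx (x r : ℝ) (p q t : Fin 3) (a : V) (A B u w : ℝ) : Prop where
  I : IC (braS x r) A B u w
  hpq : p ≠ q
  hpt : p ≠ t
  hqt : q ≠ t
  hqp : q ≠ p
  htp : t ≠ p
  htq : t ≠ q
  hA : htd a p q = A
  hB : htd a q t = B
  hC : htd a p t = A + B

lemma combine {p q t : Fin 3} (hpq : p ≠ q) (hpt : p ≠ t) (hqt : q ≠ t) {F G : Fin 3 → ℝ}
    {x1 x2 x3 y1 y2 y3 : ℝ} (h : x1 + x2 + x3 = y1 + y2 + y3)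
    (f1 : F p = x1) (f2 : F q = x2) (f3 : F t = x3)
    (g1 : G p = y1) (g2 : G q = y2) (g3 : G t = y3) : ∑ κ, F κ = ∑ κ, G κ := by
  rw [sum3 hpq hpt hqt, sum3 hpq hpt hqt, f1, f2, f3, g1, g2, g3, h]

lemma mul3 {a b c a' b' c' : ℝ} (h1 : a = a') (h2 : b = b') (h3 : c = c') :
    a * b * c = a' * b' * c' := by rw [h1, h2, h3]

lemma mul01 {a b c : ℝ} (h : a = 0) : a * b * c = 0 := by simp [h]

lemma mul02 {a b c : ℝ} (h : b = 0) : a * b * c = 0 := by simp [h]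

lemma mul03 {a b c : ℝ} (h : c = 0) : a * b * c = 0 := by simp [h]

section
variable {x r : ℝ} {p q t : Fin 3} {a : V} {A B u w : ℝ}

lemma yb_ppq_ppq (C : Ctx x r p q t a A B u w) : Y x r u w a p p q p p := by
  obtain ⟨I, hpq, hpt, hqt, hqp, htp, htq, hA, hB, hC⟩ := C
  have odd := I.odd
  exact combine hpq hpt hqt (id_ppq_ppq I _ _ _)
    (mul3 (ws_id odd hpq) (ws_diag p) (ws_diag p))
    (mul03 (ws_zero hqp hqp))
    (mul03 (ws_zero htp htp))
    (mul3 (ws_diag p) (ws_id odd hpq) (ws_id odd hpq))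
    (mul3 (ws_id odd hpq) (ws_swap hpq) (ws_swap' odd hqp))
    (mul02 (ws_zero htp htq))

lemma yb_ppq_pqp (C : Ctx x r p q t a A B u w) : Y x r u w a p p q p q := by
  obtain ⟨I, hpq, hpt, hqt, hqp, htp, htq, hA, hB, hC⟩ := C
  have odd := I.odd
  exact combine hpq hpt hqt (id_ppq_pqp I _ _ _)
    (mul3 (ws_swap hpq) (ws_id odd hpq) (ws_diag p))
    (mul03 (ws_zero hqp hqp))
    (mul03 (ws_zero htp htp))
    (mul3 (ws_diag p) (ws_id odd hpq) (ws_swap hpq))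
    (mul3 (ws_id odd hpq) (ws_swap hpq) (ws_id' hqp))
    (mul02 (ws_zero htp htq))

lemma yb_ppq_qpp (C : Ctx x r p q t a A B u w) : Y x r u w a p p q q p := by
  obtain ⟨I, hpq, hpt, hqt, hqp, htp, htq, hA, hB, hC⟩ := C
  have odd := I.odd
  exact combine hpq hpt hqt (id_ppq_qpp I _ _ _)
    (mul3 (ws_swap hpq) (ws_swap hpq) (ws_diag p))
    (mul03 (ws_zero hqp hqp))
    (mul03 (ws_zero htp htp))
    (mul01 (ws_zero hqp hqp))
    (mul3 (ws_swap hpq) (ws_swap hpq) (ws_diag p))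
    (mul01 (ws_zero hqp hqt))

lemma yb_pqp_ppq (C : Ctx x r p q t a A B u w) : Y x r u w a p q p p p := by
  obtain ⟨I, hpq, hpt, hqt, hqp, htp, htq, hA, hB, hC⟩ := C
  have odd := I.odd
  exact combine hpq hpt hqt (id_pqp_ppq I _ _ _)
    (mul3 (ws_swap' odd hqp) (ws_diag p) (ws_id odd hpq))
    (mul02 (ws_zero' hqp hqp))
    (mul03 (ws_zero htp htq))
    (mul3 (ws_diag p) (ws_swap' odd hqp) (ws_id odd hpq))
    (mul3 (ws_id odd hpq) (ws_id' hqp) (ws_swap' odd hqp))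
    (mul02 (ws_zero htq htp))

lemma yb_pqp_pqp (C : Ctx x r p q t a A B u w) : Y x r u w a p q p p q := by
  obtain ⟨I, hpq, hpt, hqt, hqp, htp, htq, hA, hB, hC⟩ := C
  have odd := I.odd
  exact combine hpq hpt hqt (id_pqp_pqp I _ _ _)
    (mul3 (ws_id' hqp) (ws_id odd hpq) (ws_id odd hpq))
    (mul3 (ws_diag p) (ws_swap' odd hqp) (ws_swap hpq))
    (mul03 (ws_zero htp htq))
    (mul3 (ws_diag p) (ws_swap' odd hqp) (ws_swap hpq))
    (mul3 (ws_id odd hpq) (ws_id' hqp) (ws_id' hqp))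
    (mul02 (ws_zero htq htp))

lemma yb_pqp_qpp (C : Ctx x r p q t a A B u w) : Y x r u w a p q p q p := by
  obtain ⟨I, hpq, hpt, hqt, hqp, htp, htq, hA, hB, hC⟩ := C
  have odd := I.odd
  exact combine hpq hpt hqt (id_pqp_qpp I _ _ _)
    (mul3 (ws_id' hqp) (ws_swap hpq) (ws_id odd hpq))
    (mul3 (ws_diag p) (ws_id' hqp) (ws_swap hpq))
    (mul03 (ws_zero htp htq))
    (mul01 (ws_zero hqp hqp))
    (mul3 (ws_swap hpq) (ws_id' hqp) (ws_diag p))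
    (mul01 (ws_zero hqp hqt))

lemma yb_qpp_ppq (C : Ctx x r p q t a A B u w) : Y x r u w a q p p p p := by
  obtain ⟨I, hpq, hpt, hqt, hqp, htp, htq, hA, hB, hC⟩ := C
  have odd := I.odd
  exact combine hpq hpt hqt (id_qpp_ppq I _ _ _)
    (mul3 (ws_swap' odd hqp) (ws_diag p) (ws_swap' odd hqp))
    (mul02 (ws_zero' hqp hqp))
    (mul03 (ws_zero htq htp))
    (mul3 (ws_swap' odd hqp) (ws_diag p) (ws_swap' odd hqp))
    (mul01 (ws_zero hpq hpq))
    (mul01 (ws_zero hpq hpt))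

lemma yb_qpp_pqp (C : Ctx x r p q t a A B u w) : Y x r u w a q p p p q := by
  obtain ⟨I, hpq, hpt, hqt, hqp, htp, htq, hA, hB, hC⟩ := C
  have odd := I.odd
  exact combine hpq hpt hqt (id_qpp_pqp I _ _ _)
    (mul3 (ws_id' hqp) (ws_id odd hpq) (ws_swap' odd hqp))
    (mul3 (ws_diag p) (ws_swap' odd hqp) (ws_id' hqp))
    (mul03 (ws_zero htq htp))
    (mul3 (ws_swap' odd hqp) (ws_diag p) (ws_id' hqp))
    (mul01 (ws_zero hpq hpq))
    (mul01 (ws_zero hpq hpt))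

lemma yb_qpp_qpp (C : Ctx x r p q t a A B u w) : Y x r u w a q p p q p := by
  obtain ⟨I, hpq, hpt, hqt, hqp, htp, htq, hA, hB, hC⟩ := C
  have odd := I.odd
  exact combine hpq hpt hqt (id_qpp_qpp I _ _ _)
    (mul3 (ws_id' hqp) (ws_swap hpq) (ws_swap' odd hqp))
    (mul3 (ws_diag p) (ws_id' hqp) (ws_id' hqp))
    (mul03 (ws_zero htq htp))
    (mul3 (ws_id' hqp) (ws_diag p) (ws_diag p))
    (mul02 (ws_zero hqp hqp))
    (mul02 (ws_zero htp htp))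

lemma yb_pqt_pqt (C : Ctx x r p q t a A B u w) : Y x r u w a p q t p q := by
  obtain ⟨I, hpq, hpt, hqt, hqp, htp, htq, hA, hB, hC⟩ := C
  have odd := I.odd
  exact combine hpq hpt hqt (id_pqt_pqt I _ _ _)
    (mul3 (ws_id odd hqt) (ws_id odd hpq) (ws_id odd hpq))
    (mul3 (ws_id odd hpt) (ws_swap' odd hqp) (ws_swap hpq))
    (mul03 (ws_zero htp htq))
    (mul02 (ws_zero hpq hpt))
    (mul3 (ws_id odd hpq) (ws_id odd hqt) (ws_id odd hqt))
    (mul3 (ws_id odd hpt) (ws_swap hqt) (ws_swap' odd htq))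

lemma yb_pqt_ptq (C : Ctx x r p q t a A B u w) : Y x r u w a p q t p t := by
  obtain ⟨I, hpq, hpt, hqt, hqp, htp, htq, hA, hB, hC⟩ := C
  have odd := I.odd
  exact combine hpq hpt hqt (id_pqt_ptq I _ _ _)
    (mul3 (ws_swap hqt) (ws_id odd hpt) (ws_id odd hpq))
    (mul02 (ws_zero' hqp hqt))
    (mul03 (ws_zero htp htq))
    (mul02 (ws_zero hpq hpt))
    (mul3 (ws_id odd hpq) (ws_id odd hqt) (ws_swap hqt))
    (mul3 (ws_id odd hpt) (ws_swap hqt) (ws_id' htq))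

lemma yb_pqt_qpt (C : Ctx x r p q t a A B u w) : Y x r u w a p q t q p := by
  obtain ⟨I, hpq, hpt, hqt, hqp, htp, htq, hA, hB, hC⟩ := C
  have odd := I.odd
  exact combine hpq hpt hqt (id_pqt_qpt I _ _ _)
    (mul3 (ws_id odd hqt) (ws_swap hpq) (ws_id odd hpq))
    (mul3 (ws_id odd hpt) (ws_id' hqp) (ws_swap hpq))
    (mul03 (ws_zero htp htq))
    (mul01 (ws_zero hqp hqp))
    (mul3 (ws_swap hpq) (ws_id odd hqt) (ws_id odd hpt))
    (mul01 (ws_zero hqp hqt))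

lemma yb_pqt_qtp (C : Ctx x r p q t a A B u w) : Y x r u w a p q t q t := by
  obtain ⟨I, hpq, hpt, hqt, hqp, htp, htq, hA, hB, hC⟩ := C
  have odd := I.odd
  exact combine hpq hpt hqt (id_pqt_qtp I _ _ _)
    (mul02 (ws_zero' hpq hpt))
    (mul3 (ws_swap hpt) (ws_id odd hqt) (ws_swap hpq))
    (mul03 (ws_zero htp htq))
    (mul01 (ws_zero hqp hqp))
    (mul3 (ws_swap hpq) (ws_id odd hqt) (ws_swap hpt))
    (mul01 (ws_zero hqp hqt))

lemma yb_pqt_tpq (C : Ctx x r p q t a A B u w) : Y x r u w a p q t t p := by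
  obtain ⟨I, hpq, hpt, hqt, hqp, htp, htq, hA, hB, hC⟩ := C
  have odd := I.odd
  exact combine hpq hpt hqt (id_pqt_tpq I _ _ _)
    (mul3 (ws_swap hqt) (ws_swap hpt) (ws_id odd hpq))
    (mul02 (ws_zero' hqt hqp))
    (mul03 (ws_zero htp htq))
    (mul01 (ws_zero htp htp))
    (mul01 (ws_zero htp htq))
    (mul3 (ws_swap hpt) (ws_swap hqt) (ws_id odd hpq))

lemma yb_pqt_tqp (C : Ctx x r p q t a A B u w) : Y x r u w a p q t t q := by
  obtain ⟨I, hpq, hpt, hqt, hqp, htp, htq, hA, hB, hC⟩ := C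
  have odd := I.odd
  exact combine hpq hpt hqt (id_pqt_tqp I _ _ _)
    (mul02 (ws_zero' hpt hpq))
    (mul3 (ws_swap hpt) (ws_swap hqt) (ws_swap hpq))
    (mul03 (ws_zero htp htq))
    (mul01 (ws_zero htp htp))
    (mul01 (ws_zero htp htq))
    (mul3 (ws_swap hpt) (ws_swap hqt) (ws_swap hpq))

lemma yb_ppp (hpq : p ≠ q) (hpt : p ≠ t) (hqt : q ≠ t) : Y x r u w a p p p p p :=
  combine (x1 := r1S x r (u + w) * r1S x r u * r1S x r w) hpq hpt hqt rfl
    (mul3 (ws_diag p) (ws_diag p) (ws_diag p))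
    (mul03 (ws_zero hpq.symm hpq.symm))
    (mul03 (ws_zero hpt.symm hpt.symm))
    (mul3 (ws_diag p) (ws_diag p) (ws_diag p))
    (mul02 (ws_zero hpq.symm hpq.symm))
    (mul02 (ws_zero hpt.symm hpt.symm))

end

lemma next_ne : ∀ p : Fin 3, ∃ q, p ≠ q := by decide

lemma third : ∀ p q : Fin 3, p ≠ q → ∃ t, p ≠ t ∧ q ≠ t := by decide

lemma perm_three {i₁ i₂ i₃ j₁ j₂ j₃ : Fin 3}
    (h : epsbar i₁ + epsbar i₂ + epsbar i₃ = epsbar j₁ + epsbar j₂ + epsbar j₃) :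
    (j₁ = i₁ ∧ j₂ = i₂) ∨ (j₁ = i₁ ∧ j₂ = i₃) ∨ (j₁ = i₂ ∧ j₂ = i₁) ∨ (j₁ = i₂ ∧ j₂ = i₃) ∨
      (j₁ = i₃ ∧ j₂ = i₁) ∨ (j₁ = i₃ ∧ j₂ = i₂) := by
  have key : j₁ = i₁ ∨ j₁ = i₂ ∨ j₁ = i₃ := by
    by_contra hn
    push Not at hn
    obtain ⟨n1, n2, n3⟩ := hn
    have := congrFun h j₁
    simp only [Pi.add_apply, epsbar_apply, if_neg n1, if_neg n2, if_neg n3, if_true] at this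
    split_ifs at this <;> norm_num at this
  rcases key with rfl | rfl | rfl
  · rcases two_step (add_left_cancel (show epsbar j₁ + (epsbar i₂ + epsbar i₃) =
      epsbar j₁ + (epsbar j₂ + epsbar j₃) by rw [← add_assoc, h, add_assoc])) with h | h
    · simp [h.1]
    · simp [h.1]
  · rcases two_step (add_left_cancel (show epsbar j₁ + (epsbar i₁ + epsbar i₃) =
      epsbar j₁ + (epsbar j₂ + epsbar j₃) by rw [← add_assoc, ← add_assoc, ← h]; abel)) with h | h
    · simp [h.1]
    · simp [h.1]
  · rcases two_step (add_left_cancel (show epsbar j₁ + (epsbar i₁ + epsbar i₂) =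
      epsbar j₁ + (epsbar j₂ + epsbar j₃) by rw [← add_assoc, ← add_assoc, ← h]; abel)) with h | h
    · simp [h.1]
    · simp [h.1]

lemma yb_all {x r u w : ℝ} {a : V}
    (C : ∀ p q t : Fin 3, p ≠ q → p ≠ t → q ≠ t →
      Ctx x r p q t a (htd a p q) (htd a q t) u w)
    {i₁ i₂ i₃ j₁ j₂ j₃ : Fin 3}
    (h : epsbar i₁ + epsbar i₂ + epsbar i₃ = epsbar j₁ + epsbar j₂ + epsbar j₃) :
    Y x r u w a i₁ i₂ i₃ j₁ j₂ := by
  have hj := perm_three h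
  clear h
  by_cases h12 : i₁ = i₂
  · subst h12
    by_cases h13 : i₁ = i₃
    · subst h13
      obtain ⟨q, hq⟩ : ∃ q, i₁ ≠ q := next_ne i₁
      obtain ⟨t, h1, h2⟩ := third _ _ hq
      simp only [or_self] at hj
      obtain ⟨rfl, rfl⟩ := hj
      exact yb_ppp hq h1 h2
    · obtain ⟨t, h1, h2⟩ := third _ _ h13
      have C := C _ _ _ h13 h1 h2
      rcases hj with ⟨rfl, rfl⟩ | ⟨rfl, rfl⟩ | ⟨rfl, rfl⟩ | ⟨rfl, rfl⟩ | ⟨rfl, rfl⟩ | ⟨rfl, rfl⟩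
      exacts [yb_ppq_ppq C, yb_ppq_pqp C, yb_ppq_ppq C, yb_ppq_pqp C, yb_ppq_qpp C, yb_ppq_qpp C]
  · by_cases h13 : i₁ = i₃
    · subst h13
      obtain ⟨t, h1, h2⟩ := third _ _ h12
      have C := C _ _ _ h12 h1 h2
      rcases hj with ⟨rfl, rfl⟩ | ⟨rfl, rfl⟩ | ⟨rfl, rfl⟩ | ⟨rfl, rfl⟩ | ⟨rfl, rfl⟩ | ⟨rfl, rfl⟩
      exacts [yb_pqp_pqp C, yb_pqp_ppq C, yb_pqp_qpp C, yb_pqp_qpp C, yb_pqp_ppq C, yb_pqp_pqp C]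
    · by_cases h23 : i₂ = i₃
      · subst h23
        obtain ⟨t, h1, h2⟩ := third _ _ (Ne.symm h12)
        have C := C _ _ _ (Ne.symm h12) h1 h2
        rcases hj with ⟨rfl, rfl⟩ | ⟨rfl, rfl⟩ | ⟨rfl, rfl⟩ | ⟨rfl, rfl⟩ | ⟨rfl, rfl⟩ | ⟨rfl, rfl⟩
        exacts [yb_qpp_qpp C, yb_qpp_qpp C, yb_qpp_pqp C, yb_qpp_ppq C, yb_qpp_pqp C,
          yb_qpp_ppq C]
      · have C := C _ _ _ h12 h13 h23
        rcases hj with ⟨rfl, rfl⟩ | ⟨rfl, rfl⟩ | ⟨rfl, rfl⟩ | ⟨rfl, rfl⟩ | ⟨rfl, rfl⟩ | ⟨rfl, rfl⟩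
        exacts [yb_pqt_pqt C, yb_pqt_ptq C, yb_pqt_qpt C, yb_pqt_qtp C, yb_pqt_tpq C,
          yb_pqt_tqp C]

lemma epsbar_mem (κ : Fin 3) : epsbar κ ∈ P := AddSubgroup.subset_closure ⟨κ, rfl⟩

/-- A sum over the lattice supported on the neighbours of `a` is a sum over `Fin 3`. -/
lemma finsum_nbr {a : V} (ha : a ∈ P) (F : V → ℝ)
    (hF : ∀ g, F g ≠ 0 → ∃ κ, g = a + epsbar κ) :
    ∑ᶠ g : P, F (g : V) = ∑ κ, F (a + epsbar κ) := by
  let φ : Fin 3 → P := fun κ => ⟨a + epsbar κ, P.add_mem ha (epsbar_mem κ)⟩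
  have hφ : Function.Injective φ := fun κ κ' h =>
    epsbar_inj (add_left_cancel (congrArg Subtype.val h))
  rw [finsum_eq_sum_of_support_subset (s := Finset.univ.map ⟨φ, hφ⟩), Finset.sum_map]
  · rfl
  · intro g hg
    obtain ⟨κ, h⟩ := hF g hg
    simp only [Finset.coe_map, Set.mem_image]
    exact ⟨κ, by simp, Subtype.ext h.symm⟩

lemma yb_sum {x r u w : ℝ} {a b c d e f : V}
    (C : ∀ p q t : Fin 3, p ≠ q → p ≠ t → q ≠ t →
      Ctx x r p q t a (htd a p q) (htd a q t) u w) :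
    ∑ κ, LT x r a b c d e f u w κ = ∑ κ, RT x r a b c d e f u w κ := by
  by_cases hs : (∃ i, f = a + epsbar i) ∧ (∃ i, e = f + epsbar i) ∧ (∃ i, d = e + epsbar i) ∧
      (∃ i, b = a + epsbar i) ∧ (∃ i, c = b + epsbar i) ∧ (∃ i, d = c + epsbar i)
  · obtain ⟨⟨i₁, rfl⟩, ⟨i₂, rfl⟩, ⟨i₃, rfl⟩, ⟨j₁, rfl⟩, ⟨j₂, rfl⟩, ⟨j₃, h⟩⟩ := hs
    refine yb_all (j₃ := j₃) C (add_left_cancel (a := a) ?_)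
    rw [← add_assoc, ← add_assoc, h, ← add_assoc, ← add_assoc]
  · have hL : ∀ κ, LT x r a b c d e f u w κ = 0 := by
      intro κ
      by_contra hn
      rw [LT] at hn
      obtain ⟨-, q1, -, q1', -, k1, -, k1'⟩ := ws_none (left_ne_zero_of_mul (left_ne_zero_of_mul hn))
      obtain ⟨-, -, p2, q2, -, -, k2, k2'⟩ := ws_none (right_ne_zero_of_mul (left_ne_zero_of_mul hn))
      obtain ⟨p3, q3, -, -, k3, k3', -, -⟩ := ws_none (right_ne_zero_of_mul hn)
      exact hs ⟨⟨_, k3⟩, ⟨_, k3'⟩, ⟨_, k1⟩, ⟨_, k2⟩, ⟨_, k2'⟩, ⟨_, k1'⟩⟩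
    have hR : ∀ κ, RT x r a b c d e f u w κ = 0 := by
      intro κ
      by_contra hn
      rw [RT] at hn
      obtain ⟨p1, -, p1', -, k1, -, k1', -⟩ := ws_none (left_ne_zero_of_mul (left_ne_zero_of_mul hn))
      obtain ⟨p2, q2, -, -, k2, k2', -, -⟩ := ws_none (right_ne_zero_of_mul (left_ne_zero_of_mul hn))
      obtain ⟨-, -, p3, q3, -, -, k3, k3'⟩ := ws_none (right_ne_zero_of_mul hn)
      exact hs ⟨⟨_, k1⟩, ⟨_, k2⟩, ⟨_, k2'⟩, ⟨_, k1'⟩, ⟨_, k3⟩, ⟨_, k3'⟩⟩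
    simp only [hL, hR]


/-- **Yang–Baxter equation** for the type-II Boltzmann weights of the
`U_{q,p}(sl₃)` ABF model. -/
theorem typeII_yang_baxter
    (x : ℝ) (hx0 : 0 < x) (hx1 : x < 1) (r : ℤ) (hr : 5 ≤ r)
    (u₁ u₂ : ℝ) (a b c d e f : V)
    (ha : a ∈ P) (hb : b ∈ P) (hc : c ∈ P) (hd : d ∈ P) (he : e ∈ P) (hf : f ∈ P)
    (hden₁ : braS x r (u₁ - 1) ≠ 0) (hden₂ : braS x r (u₂ - 1) ≠ 0)
    (hden₁₂ : braS x r (u₁ - u₂ - 1) ≠ 0)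
    (hdenH : ∀ g : V,
      (g = a ∨ g = b ∨ g = c ∨ g = d ∨ g = e ∨ g = f ∨ (∃ κ : Fin 3, g = a + epsbar κ)) →
      ∀ μ ν : Fin 3, μ ≠ ν → braS x r (htd g μ ν) ≠ 0) :
    ∑ᶠ g : P, WS x r d e c (g : V) u₁ * WS x r c (g : V) b a u₂ * WS x r e f (g : V) a (u₁ - u₂)
      = ∑ᶠ g : P,
          WS x r (g : V) f b a u₁ * WS x r d e (g : V) f u₂ * WS x r d (g : V) c b (u₁ - u₂) := by
  obtain ⟨w, rfl⟩ : ∃ w, u₁ = u₂ + w := ⟨u₁ - u₂, by ring⟩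
  rw [add_sub_cancel_left] at hden₁₂ ⊢
  have hR : (0 : ℝ) < (r : ℝ) - 1 := by
    have : (5 : ℝ) ≤ (r : ℝ) := by exact_mod_cast hr
    linarith
  have H : Three (braS x r) := bra_three hx0 hx1 hR
  have odd : ∀ v, braS x r (-v) = - braS x r v := bra_neg hx0 hx1 hR
  have C : ∀ p q t : Fin 3, p ≠ q → p ≠ t → q ≠ t →
      Ctx x r p q t a (htd a p q) (htd a q t) u₂ w := by
    intro p q t hpq hpt hqt
    have n0 := hdenH a (Or.inl rfl)
    have n1 := hdenH (a + epsbar p) (by simp) p q hpq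
    rw [htd_add, if_pos rfl, if_neg hpq, sub_zero] at n1
    exact ⟨⟨H, odd, hden₂, hden₁₂, hden₁, n0 p q hpq, n1, n0 q t hqt,
      htd_trans a p q t ▸ n0 p t hpt⟩, hpq, hpt, hqt, hpq.symm, hpt.symm, hqt.symm, rfl, rfl,
      htd_trans a p q t⟩
  rw [finsum_nbr ha (fun g => WS x r d e c g (u₂ + w) * WS x r c g b a u₂ * WS x r e f g a w),
    finsum_nbr hf (fun g => WS x r g f b a (u₂ + w) * WS x r d e g f u₂ * WS x r d g c b w)]
  · exact yb_sum C
  · intro g hn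
    obtain ⟨_, p, _, _, _, h, _, _⟩ := ws_none (left_ne_zero_of_mul (left_ne_zero_of_mul hn))
    exact ⟨p, h⟩
  · intro g hn
    obtain ⟨_, _, p, _, _, _, h, _⟩ := ws_none (right_ne_zero_of_mul hn)
    exact ⟨p, h⟩

end ABF
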